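/- Let F_{q^t} = F_q(λ) be a subfield of F_{q^n}, let S̄ be an F_{q^t}-subspace of F_{q^n} with dim_{F_{q^t}}(S̄) = l and S̄ ∩ b·F_{q^t} = {0} for some b ∈ F_{q^n}^*, let 0 < m < t, let S = S̄ ⊕ b·⟨1, λ, …, λ^{m−1}⟩_{F_q} ∈ G_q(n,k) with k = tl + m, let Y = S̄ ⊕ b·F_{q^t}, and let C = Orb(S). Then: (a) if m > (t+1)/2, then ω_{2(k−j)}(C) = 0 for every j ∈ {1,…,2m−t−1}; (b) if F_{q^t} is properly contained in H(Y), then ω_{2(k−j)}(C) = 0 for every j ∈ {1,…,2m−1}. -/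

import Mathlib

/-!
Setting: `q` is a prime power, realized by a finite field `Fq` with `Fintype.card Fq = q`;
`F` plays the role of `F_{q^n}`: a finite field extension of `Fq` with `Module.finrank Fq F = n`.
`F_q`-subspaces of `F_{q^n}` are `Submodule Fq F`; for a divisor `t` of `n`, the subfield
`F_{q^t}` is the (unique) `T : IntermediateField Fq F` with `Module.finrank Fq ↥T = t`, and
`F_{q^t}`-subspaces are `Submodule ↥T F`.
-/

set_option synthInstance.maxHeartbeats 1000000

namespace FWS

variable (R : Type*) {F : Type*} [Field R] [Field F] [Algebra R F]

/-- The cyclic shift `α S = {α * s : s ∈ S}` of an `R`-subspace `S` of `F`. -/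
def shift (α : F) (S : Submodule R F) : Submodule R F :=
  S.map (LinearMap.mulLeft R α)

/-- The subspace distance `d(U,V) = dim U + dim V - 2 dim (U ⊓ V)`
(which is `2k - 2 dim (U ⊓ V)` for `U, V` of the same dimension `k`). -/
noncomputable def sdist (U V : Submodule R F) : ℕ :=
  Module.finrank R ↥U + Module.finrank R ↥V - 2 * Module.finrank R ↥(U ⊓ V)

/-- The one-orbit cyclic subspace code `Orb(S) = {α S : α ∈ F*}`. -/
def orb (S : Submodule R F) : Set (Submodule R F) :=
  {T | ∃ α : F, α ≠ 0 ∧ T = shift R α S}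

/-- The weight `ω_{2i}(Orb(S)) = #{α S : α ∈ F*, d(S, α S) = 2 i}`. -/
noncomputable def omega (S : Submodule R F) (i : ℕ) : ℕ :=
  Nat.card {T : Submodule R F // T ∈ orb R S ∧ sdist R S T = 2 * i}

/-- `Orb(S)` is a full weight spectrum (FWS) code: `ω_{2i} > 0` for all `1 ≤ i ≤ dim S`. -/
def IsFWS (S : Submodule R F) : Prop :=
  ∀ i : ℕ, 1 ≤ i → i ≤ Module.finrank R ↥S → 0 < omega R S i

/-- The subspace `⟨1, l, ..., l^(k-1)⟩_R` spanned by the first `k` powers of `l`. -/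
def polySpan (l : F) (k : ℕ) : Submodule R F :=
  Submodule.span R ((fun i : ℕ => l ^ i) '' Set.Iio k)

/-- The invariant `m(Orb(S))`: the least divisor `t` of `n` such that
`dim_{F_{q^t}} ⟨S⟩_{F_{q^t}} = 1` (equivalently, the degree of the smallest subfield
containing a cyclic shift of `S`). -/
noncomputable def mOrb (S : Submodule R F) : ℕ :=
  sInf {t : ℕ | t ∣ Module.finrank R F ∧
    ∃ T : IntermediateField R F, Module.finrank R ↥T = t ∧
      Module.finrank ↥T ↥(Submodule.span ↥T (S : Set F)) = 1}

/-- The stabilizer `H(S) = {x ∈ F* : x S = S} ∪ {0}` of a set `S ⊆ F`, as a subset of `F`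
(it is a subfield of `F` when `S` is a subspace). -/
def stab {F : Type*} [Field F] (S : Set F) : Set F :=
  {x : F | x ≠ 0 ∧ (fun y => x * y) '' S = S} ∪ {0}

end FWS

open FWS

namespace FWS

section

variable {K F : Type*} [Field K] [Field F] [Algebra K F]

theorem mem_shift {α x : F} {S : Submodule K F} : x ∈ shift K α S ↔ ∃ y ∈ S, α * y = x := by
  simp [shift]

theorem finrank_shift {α : F} (hα : α ≠ 0) (S : Submodule K F) :
    Module.finrank K ↥(shift K α S) = Module.finrank K ↥S :=
  (S.equivMapOfInjective (LinearMap.mulLeft K α) (mul_right_injective₀ hα)).finrank_eq.symm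

theorem restrictScalars_shift (T : IntermediateField K F) (α : F) (Y : Submodule ↥T F) :
    (shift ↥T α Y).restrictScalars K = shift K α (Y.restrictScalars K) := by
  ext x
  simp [mem_shift]

theorem finrank_restrictScalars (T : IntermediateField K F) (Y : Submodule ↥T F) :
    Module.finrank K ↥(Y.restrictScalars K) = Module.finrank K ↥T * Module.finrank ↥T ↥Y :=
  (Module.finrank_mul_finrank K ↥T ↥Y).symm

theorem shift_polySpan_le (T : IntermediateField K F) {lam : F} (hlam : lam ∈ T) (b : F) (m : ℕ) :
    shift K b (polySpan K lam m) ≤ (Submodule.span ↥T {b}).restrictScalars K := by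
  rw [shift, polySpan, Submodule.map_span_le]
  rintro _ ⟨i, -, rfl⟩
  exact Submodule.mem_span_singleton.2 ⟨⟨lam ^ i, pow_mem hlam i⟩, mul_comm _ _⟩

theorem finrank_sup_span_singleton [FiniteDimensional K F] {V : Submodule K F} {b : F}
    (hb : b ≠ 0) (hV : Submodule.span K {b} ⊓ V = ⊥) :
    Module.finrank K ↥(V ⊔ Submodule.span K {b}) = Module.finrank K ↥V + 1 := by
  have h := Submodule.finrank_sup_add_finrank_inf_eq V (Submodule.span K {b})
  rwa [inf_comm, hV, finrank_bot, finrank_span_singleton hb, add_zero] at h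

/-- Two subspaces of codimension at most `c` in `Y` and `Y'` meet in codimension at most `2 c`
in `Y ⊓ Y'`. -/
theorem finrank_inf_le_finrank_inf_add [FiniteDimensional K F] {S S' Y Y' : Submodule K F} {c : ℕ}
    (hS : S ≤ Y) (hS' : S' ≤ Y') (hY : Module.finrank K ↥Y ≤ Module.finrank K ↥S + c)
    (hY' : Module.finrank K ↥Y' ≤ Module.finrank K ↥S' + c) :
    Module.finrank K ↥(Y ⊓ Y') ≤ Module.finrank K ↥(S ⊓ S') + 2 * c := by
  have h₁ := Submodule.finrank_sup_add_finrank_inf_eq S (Y ⊓ Y')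
  have h₂ := Submodule.finrank_sup_add_finrank_inf_eq S' (Y ⊓ Y')
  have h₃ := Submodule.finrank_sup_add_finrank_inf_eq (S ⊓ (Y ⊓ Y')) (S' ⊓ (Y ⊓ Y'))
  have h₄ := Submodule.finrank_mono (sup_le hS inf_le_left : S ⊔ Y ⊓ Y' ≤ Y)
  have h₅ := Submodule.finrank_mono (sup_le hS' inf_le_right : S' ⊔ Y ⊓ Y' ≤ Y')
  have h₆ := Submodule.finrank_mono
    (sup_le inf_le_right inf_le_right : S ⊓ (Y ⊓ Y') ⊔ S' ⊓ (Y ⊓ Y') ≤ Y ⊓ Y')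
  rw [← inf_inf_distrib_right, inf_eq_left.2 (inf_le_inf hS hS')] at h₃
  omega

theorem mul_mem_of_mem_stab {Y : Submodule K F} {h x : F} (hh : h ∈ stab (Y : Set F))
    (hx : x ∈ Y) : h * x ∈ Y := by
  rcases hh with ⟨-, hh⟩ | rfl
  · exact hh.subset (Set.mem_image_of_mem _ hx)
  · simp

theorem two_le_finrank_of_mul_mem [FiniteDimensional K F] (T : IntermediateField K F)
    {Z : Submodule ↥T F} {h x : F} (hh : h ∉ T) (hx : x ∈ Z) (hx0 : x ≠ 0) (hhx : h * x ∈ Z) :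
    2 ≤ Module.finrank ↥T ↥Z := by
  have hli : LinearIndependent ↥T ![x, h * x] := by
    rw [LinearIndependent.pair_iff' hx0]
    intro a ha
    exact hh (mul_right_cancel₀ hx0 ha ▸ a.2)
  have hle : Submodule.span ↥T (Set.range ![x, h * x]) ≤ Z := by
    rw [Submodule.span_le]
    rintro _ ⟨i, rfl⟩
    fin_cases i
    exacts [hx, hhx]
  simpa [finrank_span_eq_card hli] using Submodule.finrank_mono hle

/-- If the intersections of `S` with its shifts never have dimension in `[1, d)`, then the
weights `ω_{2(k-j)}`, `1 ≤ j < d`, vanish. -/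
theorem omega_eq_zero {S : Submodule K F} [FiniteDimensional K F] {d : ℕ}
    (hS : 0 < Module.finrank K ↥S)
    (h : ∀ α : F, α ≠ 0 → S ⊓ shift K α S ≠ ⊥ → d ≤ Module.finrank K ↥(S ⊓ shift K α S))
    {j : ℕ} (hj : 1 ≤ j) (hjd : j < d) : omega K S (Module.finrank K ↥S - j) = 0 := by
  rw [omega, Nat.card_eq_zero]
  left
  rw [isEmpty_subtype]
  rintro _ ⟨⟨α, hα, rfl⟩, hd⟩
  rw [sdist, finrank_shift hα] at hd
  have hle := Submodule.finrank_mono (inf_le_left : S ⊓ shift K α S ≤ S)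
  by_cases h0 : S ⊓ shift K α S = ⊥
  · rw [h0, finrank_bot] at hd
    omega
  · have := h α hα h0
    omega

end

end FWS

/-- Theorem 6.4(ii)-(iii): for `S = S̄ ⊕ b⟨1, λ, …, λ^(m-1)⟩_{F_q}` with
`Y = S̄ ⊕ b F_{q^t}`: (a) if `m > (t+1)/2` then `ω_{2(k-j)} = 0` for `j ∈ {1,…,2m-t-1}`;
(b) if `F_{q^t} ⊊ H(Y)` then `ω_{2(k-j)} = 0` for `j ∈ {1,…,2m-1}`. -/
theorem omega_top_weights_eq_zero
    {Fq F : Type*} [Field Fq] [Field F] [Algebra Fq F] [Fintype Fq] [Fintype F]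
    (q n t : ℕ) (hq : Fintype.card Fq = q) (hn : Module.finrank Fq F = n)
    (lam : F) (hlam : lam ∉ Set.range (algebraMap Fq F))
    (T : IntermediateField Fq F) (hTlam : IntermediateField.adjoin Fq {lam} = T)
    (hT : Module.finrank Fq ↥T = t)
    (Sbar : Submodule ↥T F) (l : ℕ) (hSbar : Module.finrank ↥T ↥Sbar = l)
    (b : F) (hb : b ≠ 0) (hbS : Submodule.span ↥T {b} ⊓ Sbar = ⊥)
    (m k : ℕ) (hm0 : 0 < m) (hmt : m < t) (hk : k = t * l + m)
    (S : Submodule Fq F)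
    (hS : S = Sbar.restrictScalars Fq ⊔ shift Fq b (polySpan Fq lam m))
    (hSk : Module.finrank Fq ↥S = k)
    (Y : Submodule ↥T F) (hY : Y = Sbar ⊔ Submodule.span ↥T {b}) :
    (t + 1 < 2 * m →
      ∀ j : ℕ, 1 ≤ j → j ≤ 2 * m - t - 1 → omega Fq S (k - j) = 0) ∧
    ((T : Set F) ⊂ stab (Y : Set F) →
      ∀ j : ℕ, 1 ≤ j → j ≤ 2 * m - 1 → omega Fq S (k - j) = 0) := by
  have hlamT : lam ∈ T := hTlam ▸ IntermediateField.mem_adjoin_simple_self Fq lam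
  have hSY : S ≤ Y.restrictScalars Fq := by
    rw [hS, hY]
    exact sup_le (le_sup_left (a := Sbar))
      ((shift_polySpan_le T hlamT b m).trans (le_sup_right (a := Sbar)))
  have hYdim : Module.finrank Fq ↥(Y.restrictScalars Fq) = Module.finrank Fq ↥S + (t - m) := by
    rw [finrank_restrictScalars, hY, finrank_sup_span_singleton hb hbS, hT, hSbar, hSk, hk,
      mul_add]
    omega
  have hbound (α : F) (hα : α ≠ 0) : t * Module.finrank ↥T ↥(Y ⊓ shift ↥T α Y) ≤
      Module.finrank Fq ↥(S ⊓ shift Fq α S) + 2 * (t - m) := by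
    rw [← hT, ← finrank_restrictScalars, Submodule.restrictScalars_inf, restrictScalars_shift, hT]
    refine finrank_inf_le_finrank_inf_add hSY (Submodule.map_mono hSY) hYdim.le ?_
    rw [finrank_shift hα, finrank_shift hα, hYdim]
  have hexists (α : F) (h : S ⊓ shift Fq α S ≠ ⊥) : ∃ x ∈ Y ⊓ shift ↥T α Y, x ≠ 0 := by
    obtain ⟨x, ⟨hxS, hxα⟩, hx0⟩ := Submodule.exists_mem_ne_zero_of_ne_bot h
    obtain ⟨y, hy, rfl⟩ := mem_shift.1 hxα
    exact ⟨_, ⟨hSY hxS, mem_shift.2 ⟨y, hSY hy, rfl⟩⟩, hx0⟩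
  have hSpos : 0 < Module.finrank Fq ↥S := by omega
  rw [← hSk]
  constructor
  · intro hm j hj hj'
    refine omega_eq_zero (d := 2 * m - t) hSpos (fun α hα h => ?_) hj (by omega)
    obtain ⟨x, hx, hx0⟩ := hexists α h
    have hpos : 1 ≤ Module.finrank ↥T ↥(Y ⊓ shift ↥T α Y) :=
      Submodule.one_le_finrank_iff.2 fun h0 => hx0 (by simpa [h0] using hx)
    have := hbound α hα
    have := Nat.mul_le_mul_left t hpos
    omega
  · intro hstab j hj hj'
    obtain ⟨g, hg, hgT⟩ := Set.exists_of_ssubset hstab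
    refine omega_eq_zero (d := 2 * m) hSpos (fun α hα h => ?_) hj (by omega)
    obtain ⟨x, ⟨hxY, hxα⟩, hx0⟩ := hexists α h
    obtain ⟨y, hy, rfl⟩ := mem_shift.1 hxα
    have htwo : 2 ≤ Module.finrank ↥T ↥(Y ⊓ shift ↥T α Y) :=
      two_le_finrank_of_mul_mem T hgT ⟨hxY, hxα⟩ hx0 ⟨mul_mem_of_mem_stab hg hxY,
        mem_shift.2 ⟨g * y, mul_mem_of_mem_stab hg hy, mul_left_comm _ _ _⟩⟩
    have := hbound α hα
    have := Nat.mul_le_mul_left t htwo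
    omega
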